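/- arXiv:1612.02592 — 2 statements merged into one kernel-verified Lean document; each statement's English description precedes it below -/
import Mathlib

section
/- Let (X,ρ) be a compact metric space, f : X → X continuous, and x ∈ X. Then entr⁻(f,x) ≤ entr⁺(f,x) ≤ h_top(f restricted to the closure of the forward orbit {f^n(x) : n ≥ 0}) ≤ h_top(f), where h_top denotes Bowen's topological entropy. -/
open Filter Topology Set MeasureTheory

section Defs

variable {X : Type*} [MetricSpace X]

/-- Bowen's metric `ρ^f_m(y,z) = max_{0 ≤ i < m} ρ(f^i y, f^i z)`. -/
noncomputable def bowenDist (f : X → X) (m : ℕ) (y z : X) : ℝ :=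
  (((Finset.range m).sup fun i => nndist (f^[i] y) (f^[i] z)) : NNReal)

open scoped Classical in
/-- The correlation sum `C^f_m(x,n,ε)`. -/
noncomputable def corrSum (f : X → X) (m : ℕ) (x : X) (n : ℕ) (ε : ℝ) : ℝ :=
  (((Finset.range n ×ˢ Finset.range n).filter fun q =>
      bowenDist f m (f^[q.1] x) (f^[q.2] x) ≤ ε).card : ℝ) / (n : ℝ) ^ 2

/-- `ĉ^f_m(x,ε) = limsup_{n→∞} C^f_m(x,n,ε)`. -/
noncomputable def corrUpper (f : X → X) (m : ℕ) (x : X) (ε : ℝ) : ℝ :=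
  Filter.limsup (fun n : ℕ => corrSum f m x n ε) Filter.atTop

/-- `č^f_m(x,ε) = liminf_{n→∞} C^f_m(x,n,ε)`. -/
noncomputable def corrLower (f : X → X) (m : ℕ) (x : X) (ε : ℝ) : ℝ :=
  Filter.liminf (fun n : ℕ => corrSum f m x n ε) Filter.atTop

/-- The upper local correlation entropy `entr⁺(f,x) = lim_{ε→0⁺} limsup_m (−1/m) log č^f_m(x,ε)`;
the limit as `ε → 0⁺` exists by monotonicity in `ε`, and is expressed here as a `limsup`
along `𝓝[>] 0` (with values in `EReal`). -/
noncomputable def entrUpper (f : X → X) (x : X) : EReal :=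
  Filter.limsup (fun ε : ℝ =>
      Filter.limsup (fun m : ℕ => ((-(1 / (m : ℝ)) * Real.log (corrLower f m x ε) : ℝ) : EReal))
        Filter.atTop)
    (𝓝[>] (0 : ℝ))

/-- The lower local correlation entropy `entr⁻(f,x) = lim_{ε→0⁺} liminf_m (−1/m) log ĉ^f_m(x,ε)`. -/
noncomputable def entrLower (f : X → X) (x : X) : EReal :=
  Filter.limsup (fun ε : ℝ =>
      Filter.liminf (fun m : ℕ => ((-(1 / (m : ℝ)) * Real.log (corrUpper f m x ε) : ℝ) : EReal))
        Filter.atTop)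
    (𝓝[>] (0 : ℝ))

/-- `r_m(ε,K)`: the smallest cardinality of a subset of `K` which `(m,ε)`-spans `K`. -/
noncomputable def spanNumOn (f : X → X) (K : Set X) (m : ℕ) (ε : ℝ) : ℕ :=
  sInf {k : ℕ | ∃ A : Finset X, ↑A ⊆ K ∧ A.card = k ∧ ∀ y ∈ K, ∃ a ∈ A, bowenDist f m y a ≤ ε}

/-- Bowen's topological entropy of `f` on `K` (for `K = univ`, of `f` itself;
for closed invariant `K`, of the restriction of `f` to `K`). -/
noncomputable def topEntropyOn (f : X → X) (K : Set X) : EReal :=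
  Filter.limsup (fun ε : ℝ =>
      Filter.limsup (fun n : ℕ => (((1 / (n : ℝ)) * Real.log (spanNumOn f K n ε) : ℝ) : EReal))
        Filter.atTop)
    (𝓝[>] (0 : ℝ))

end Defs

section Bowen

variable {X : Type*} [MetricSpace X]

theorem bowenDist_le_iff (f : X → X) (m : ℕ) (y z : X) {ε : ℝ} (hε : 0 ≤ ε) :
    bowenDist f m y z ≤ ε ↔ ∀ i < m, dist (f^[i] y) (f^[i] z) ≤ ε := by
  lift ε to NNReal using hε
  simp [bowenDist, ← coe_nndist]

theorem bowenDist_self (f : X → X) (m : ℕ) (y : X) : bowenDist f m y y = 0 := by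
  simp [bowenDist]

theorem bowenDist_le_of_le_half {f : X → X} {m : ℕ} {y z w : X} {ε : ℝ} (hε : 0 ≤ ε)
    (h₁ : bowenDist f m y z ≤ ε / 2) (h₂ : bowenDist f m w z ≤ ε / 2) :
    bowenDist f m y w ≤ ε := by
  rw [bowenDist_le_iff _ _ _ _ (by positivity)] at h₁ h₂ ⊢
  intro i hi
  have := dist_triangle_right (f^[i] y) (f^[i] w) (f^[i] z)
  linarith [h₁ i hi, h₂ i hi]

theorem continuous_bowenDist_left {f : X → X} (hf : Continuous f) (m : ℕ) (z : X) :
    Continuous fun y => bowenDist f m y z := by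
  unfold bowenDist
  refine NNReal.continuous_coe.comp (Continuous.finset_sup_apply fun i _ => ?_)
  exact (hf.iterate i).nndist continuous_const

theorem exists_finset_spanning {f : X → X} (hf : Continuous f) {K : Set X} (hK : IsCompact K)
    (m : ℕ) {ε : ℝ} (hε : 0 < ε) :
    ∃ A : Finset X, ↑A ⊆ K ∧ ∀ y ∈ K, ∃ a ∈ A, bowenDist f m y a ≤ ε := by
  obtain ⟨A, hAK, hA⟩ := hK.elim_nhds_subcover (fun a => {y | bowenDist f m y a < ε})
    fun a _ => (isOpen_lt (continuous_bowenDist_left hf m a) continuous_const).mem_nhds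
      (by simpa [bowenDist_self] using hε)
  refine ⟨A, fun a ha => hAK a ha, fun y hy => ?_⟩
  obtain ⟨a, ha, hya⟩ := mem_iUnion₂.1 (hA hy)
  exact ⟨a, ha, le_of_lt hya⟩

theorem exists_finset_card_eq_spanNumOn {f : X → X} (hf : Continuous f) {K : Set X}
    (hK : IsCompact K) (m : ℕ) {ε : ℝ} (hε : 0 < ε) :
    ∃ A : Finset X, ↑A ⊆ K ∧ A.card = spanNumOn f K m ε ∧
      ∀ y ∈ K, ∃ a ∈ A, bowenDist f m y a ≤ ε := by
  obtain ⟨A, hAK, hA⟩ := exists_finset_spanning hf hK m hε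
  exact Nat.sInf_mem (s := {k : ℕ | ∃ A : Finset X, ↑A ⊆ K ∧ A.card = k ∧
    ∀ y ∈ K, ∃ a ∈ A, bowenDist f m y a ≤ ε}) ⟨A.card, A, hAK, rfl, hA⟩

theorem spanNumOn_le_half {f : X → X} (hf : Continuous f) {K L : Set X} (hL : IsCompact L)
    (hKL : K ⊆ L) (m : ℕ) {ε : ℝ} (hε : 0 < ε) :
    spanNumOn f K m ε ≤ spanNumOn f L m (ε / 2) := by
  classical
  obtain ⟨A, -, hcard, hA⟩ := exists_finset_card_eq_spanNumOn hf hL m (half_pos hε)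
  let B := A.filter fun a => ∃ y ∈ K, bowenDist f m y a ≤ ε / 2
  have hB : ∀ a ∈ B, ∃ y ∈ K, bowenDist f m y a ≤ ε / 2 := fun a ha => (Finset.mem_filter.1 ha).2
  choose! g hgK hg using hB
  calc spanNumOn f K m ε ≤ (B.image g).card := by
        refine Nat.sInf_le ⟨B.image g, ?_, rfl, fun y hy => ?_⟩
        · intro z hz
          obtain ⟨a, ha, rfl⟩ := Finset.mem_image.1 (Finset.mem_coe.1 hz)
          exact hgK a ha
        · obtain ⟨a, ha, hya⟩ := hA y (hKL hy)
          have haB : a ∈ B := Finset.mem_filter.2 ⟨ha, y, hy, hya⟩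
          exact ⟨g a, Finset.mem_image_of_mem g haB,
            bowenDist_le_of_le_half hε.le hya (hg a haB)⟩
    _ ≤ A.card := Finset.card_image_le.trans (Finset.card_filter_le _ _)
    _ = spanNumOn f L m (ε / 2) := hcard

theorem spanNumOn_pos {f : X → X} (hf : Continuous f) {K : Set X} (hK : IsCompact K)
    (hne : K.Nonempty) (m : ℕ) {ε : ℝ} (hε : 0 < ε) : 0 < spanNumOn f K m ε := by
  obtain ⟨A, -, hcard, hA⟩ := exists_finset_card_eq_spanNumOn hf hK m hε
  obtain ⟨a, ha, -⟩ := hA _ hne.some_mem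
  exact hcard ▸ Finset.card_pos.2 ⟨a, ha⟩

/-- If `n` points are distributed into the classes indexed by `A`, then at least `n² / |A|`
pairs lie in a common class. -/
theorem sq_le_card_mul_card_filter_eq {α : Type*} [DecidableEq α] (A : Finset α) (g : ℕ → α)
    (hg : ∀ i, g i ∈ A) (n : ℕ) :
    n ^ 2 ≤ A.card *
      ((Finset.range n ×ˢ Finset.range n).filter fun q => g q.1 = g q.2).card := by
  let F : α → Finset ℕ := fun a => (Finset.range n).filter fun i => g i = a
  have hn : n = ∑ a ∈ A, (F a).card := by
    simpa using Finset.card_eq_sum_card_fiberwise (s := Finset.range n) (t := A) (f := g)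
      fun i _ => hg i
  calc n ^ 2 = (∑ a ∈ A, (F a).card) ^ 2 := by rw [← hn]
    _ ≤ A.card * ∑ a ∈ A, (F a).card ^ 2 := sq_sum_le_card_mul_sum_sq
    _ = A.card * (A.biUnion fun a => F a ×ˢ F a).card := by
        rw [Finset.card_biUnion]
        · simp [sq]
        · intro a _ b _ hab
          refine Finset.disjoint_left.2 fun q ha hb => hab ?_
          simp only [F, Finset.mem_product, Finset.mem_filter] at ha hb
          exact ha.1.2.symm.trans hb.1.2
    _ ≤ _ := by
        refine Nat.mul_le_mul_left _ (Finset.card_le_card fun q hq => ?_)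
        simp only [F, Finset.mem_biUnion, Finset.mem_product, Finset.mem_filter] at hq ⊢
        obtain ⟨a, -, h₁, h₂⟩ := hq
        exact ⟨⟨h₁.1, h₂.1⟩, h₁.2.trans h₂.2.symm⟩

theorem corrSum_nonneg (f : X → X) (m : ℕ) (x : X) (n : ℕ) (ε : ℝ) :
    0 ≤ corrSum f m x n ε := by
  unfold corrSum
  positivity

theorem corrSum_le_one (f : X → X) (m : ℕ) (x : X) (n : ℕ) (ε : ℝ) :
    corrSum f m x n ε ≤ 1 := by
  unfold corrSum
  refine div_le_one_of_le₀ ?_ (by positivity)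
  exact_mod_cast (Finset.card_filter_le _ _).trans (by simp [sq])

theorem isBoundedUnder_le_corrSum (f : X → X) (m : ℕ) (x : X) (ε : ℝ) :
    IsBoundedUnder (· ≤ ·) atTop fun n : ℕ => corrSum f m x n ε :=
  isBoundedUnder_of ⟨1, fun n => corrSum_le_one f m x n ε⟩

theorem isBoundedUnder_ge_corrSum (f : X → X) (m : ℕ) (x : X) (ε : ℝ) :
    IsBoundedUnder (· ≥ ·) atTop fun n : ℕ => corrSum f m x n ε :=
  isBoundedUnder_of ⟨0, fun n => corrSum_nonneg f m x n ε⟩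

theorem inv_spanNumOn_le_corrSum {f : X → X} (hf : Continuous f) {K : Set X} (hK : IsCompact K)
    {x : X} (hx : ∀ i, f^[i] x ∈ K) (m : ℕ) {n : ℕ} (hn : 0 < n) {ε : ℝ} (hε : 0 < ε) :
    (spanNumOn f K m (ε / 2) : ℝ)⁻¹ ≤ corrSum f m x n ε := by
  classical
  have hpos := spanNumOn_pos hf hK ⟨_, hx 0⟩ m (half_pos hε)
  obtain ⟨A, -, hcard, hA⟩ := exists_finset_card_eq_spanNumOn hf hK m (half_pos hε)
  choose g hgA hg using fun i => hA _ (hx i)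
  have key := sq_le_card_mul_card_filter_eq A g hgA n
  rw [hcard] at key
  have hsub : ((Finset.range n ×ˢ Finset.range n).filter fun q => g q.1 = g q.2).card ≤
      ((Finset.range n ×ˢ Finset.range n).filter fun q =>
        bowenDist f m (f^[q.1] x) (f^[q.2] x) ≤ ε).card := by
    refine Finset.card_le_card (Finset.monotone_filter_right _ fun q _ hq => ?_)
    exact bowenDist_le_of_le_half hε.le (hg q.1) ((show g q.1 = g q.2 from hq) ▸ hg q.2)
  have key' := key.trans (Nat.mul_le_mul_left _ hsub)
  unfold corrSum
  rw [le_div_iff₀ (by positivity), inv_mul_le_iff₀ (by exact_mod_cast hpos)]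
  convert (Nat.cast_le (α := ℝ)).2 key' using 1 <;> push_cast <;> rfl

theorem inv_spanNumOn_le_corrLower {f : X → X} (hf : Continuous f) {K : Set X} (hK : IsCompact K)
    {x : X} (hx : ∀ i, f^[i] x ∈ K) (m : ℕ) {ε : ℝ} (hε : 0 < ε) :
    (spanNumOn f K m (ε / 2) : ℝ)⁻¹ ≤ corrLower f m x ε :=
  le_liminf_of_le (isBoundedUnder_le_corrSum f m x ε).isCoboundedUnder_ge
    ((eventually_gt_atTop 0).mono fun _ hn => inv_spanNumOn_le_corrSum hf hK hx m hn hε)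

theorem corrLower_le_corrUpper (f : X → X) (m : ℕ) (x : X) (ε : ℝ) :
    corrLower f m x ε ≤ corrUpper f m x ε :=
  liminf_le_limsup (isBoundedUnder_le_corrSum f m x ε) (isBoundedUnder_ge_corrSum f m x ε)

theorem corrLower_pos [CompactSpace X] {f : X → X} (hf : Continuous f) (m : ℕ) (x : X) {ε : ℝ}
    (hε : 0 < ε) : 0 < corrLower f m x ε := by
  refine lt_of_lt_of_le ?_ (inv_spanNumOn_le_corrLower hf isCompact_univ (x := x)
    (fun _ => mem_univ _) m hε)
  have := spanNumOn_pos hf isCompact_univ ⟨x, mem_univ x⟩ m (half_pos hε)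
  positivity

theorem limsup_nhdsGT_zero_le_of_le_half {F G : ℝ → EReal}
    (h : ∀ ε : ℝ, 0 < ε → F ε ≤ G (ε / 2)) :
    limsup F (𝓝[>] (0 : ℝ)) ≤ limsup G (𝓝[>] (0 : ℝ)) := by
  have ht : Tendsto (fun ε : ℝ => ε / 2) (𝓝[>] 0) (𝓝[>] 0) := by
    refine tendsto_nhdsWithin_iff.2 ⟨?_, ?_⟩
    · exact ((continuous_id.div_const (2 : ℝ)).tendsto' 0 0 (by simp)).mono_left
        nhdsWithin_le_nhds
    · filter_upwards [self_mem_nhdsWithin] with ε hε using half_pos (mem_Ioi.1 hε)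
  calc limsup F (𝓝[>] (0 : ℝ)) ≤ limsup (fun ε => G (ε / 2)) (𝓝[>] (0 : ℝ)) :=
        limsup_le_limsup (by filter_upwards [self_mem_nhdsWithin] with ε hε using h ε hε)
    _ = limsup G (map (fun ε : ℝ => ε / 2) (𝓝[>] 0)) := limsup_comp G _ _
    _ ≤ limsup G (𝓝[>] (0 : ℝ)) := limsup_le_limsup_of_le ht

theorem topEntropyOn_mono {f : X → X} (hf : Continuous f) {K L : Set X} (hK : IsCompact K)
    (hne : K.Nonempty) (hL : IsCompact L) (hKL : K ⊆ L) :
    topEntropyOn f K ≤ topEntropyOn f L := by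
  refine limsup_nhdsGT_zero_le_of_le_half fun ε hε =>
    limsup_le_limsup (Eventually.of_forall fun m => EReal.coe_le_coe_iff.2 ?_)
  have hpos := spanNumOn_pos hf hK hne m hε
  have hle := spanNumOn_le_half hf hL hKL m hε
  gcongr

theorem entrUpper_le_topEntropyOn {f : X → X} (hf : Continuous f) {K : Set X} (hK : IsCompact K)
    {x : X} (hx : ∀ i, f^[i] x ∈ K) : entrUpper f x ≤ topEntropyOn f K := by
  refine limsup_nhdsGT_zero_le_of_le_half fun ε hε =>
    limsup_le_limsup (Eventually.of_forall fun m => EReal.coe_le_coe_iff.2 ?_)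
  have hpos := spanNumOn_pos hf hK ⟨_, hx 0⟩ m (half_pos hε)
  have hlog := Real.log_le_log (by positivity) (inv_spanNumOn_le_corrLower hf hK hx m hε)
  rw [Real.log_inv] at hlog
  rw [neg_mul, ← mul_neg]
  gcongr
  linarith

theorem entrLower_le_entrUpper [CompactSpace X] {f : X → X} (hf : Continuous f) (x : X) :
    entrLower f x ≤ entrUpper f x := by
  refine limsup_le_limsup ?_
  filter_upwards [self_mem_nhdsWithin] with ε hε
  refine (liminf_le_limsup (by isBoundedDefault) (by isBoundedDefault)).trans
    (limsup_le_limsup (Eventually.of_forall fun m => EReal.coe_le_coe_iff.2 ?_))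
  have hlog := Real.log_le_log (corrLower_pos hf m x hε) (corrLower_le_corrUpper f m x ε)
  rw [neg_mul, neg_mul]
  gcongr

end Bowen

/-- `entr⁻(f,x) ≤ entr⁺(f,x) ≤ h_top(f|_{closure orbit(x)}) ≤ h_top(f)`. -/
theorem entr_le_topEntropy {X : Type*} [MetricSpace X] [CompactSpace X] (f : X → X)
    (hf : Continuous f) (x : X) :
    entrLower f x ≤ entrUpper f x ∧
    entrUpper f x ≤ topEntropyOn f (closure {y : X | ∃ n : ℕ, y = f^[n] x}) ∧
    topEntropyOn f (closure {y : X | ∃ n : ℕ, y = f^[n] x}) ≤ topEntropyOn f Set.univ := by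
  have horbit : ∀ n, f^[n] x ∈ closure {y : X | ∃ n : ℕ, y = f^[n] x} := fun n =>
    subset_closure ⟨n, rfl⟩
  exact ⟨entrLower_le_entrUpper hf x,
    entrUpper_le_topEntropyOn hf isClosed_closure.isCompact horbit,
    topEntropyOn_mono hf isClosed_closure.isCompact ⟨_, horbit 0⟩ isCompact_univ (subset_univ _)⟩
end

section
/- Let p ≥ 2, let x ∈ Σ_p be an almost periodic point of the full shift (Σ_p, σ), and let (l_j)_{j≥1} be an increasing sequence of positive integers such that l_{j+1} is a multiple of l_j for every j. Assume that for every j ≥ 1 and every word v of length l_j over {0,…,p−1}, the set N_x^{(l_j)}(v) = {i ∈ ℕ₀ : x[i·l_j, (i+1)·l_j) = v} is uniform Cesàro. Then the subshift on the orbit closure of x, (closure{σ^n(x) : n ≥ 0}, σ), is strictly ergodic, i.e., minimal and uniquely ergodic. -/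
open Filter Topology Set MeasureTheory

/-- The one-sided full shift map `σ` on `Σ_p = {0,…,p−1}^{ℕ₀}`. -/
def shiftMap (p : ℕ) : (ℕ → Fin p) → (ℕ → Fin p) := fun x n => x (n + 1)

/-- The metric `d(x,y) = 2^{-min{i : x_i ≠ y_i}}` on `Σ_p`
(`PiNat.dist x y = (1/2) ^ PiNat.firstDiff x y` for `x ≠ y`). -/
noncomputable instance fullShiftMetric (p : ℕ) : MetricSpace (ℕ → Fin p) := PiNat.metricSpace

open scoped Classical in
/-- `A ⊆ ℕ₀` is uniform Cesàro with density `α ≥ 0` if the relative frequencies of `A` in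
windows `[j, j+n)` converge to `α` as `n → ∞`, uniformly in `j`. -/
def UniformCesaro (A : Set ℕ) : Prop :=
  ∃ α : ℝ, 0 ≤ α ∧ ∀ ε : ℝ, 0 < ε → ∃ n₀ : ℕ, ∀ n : ℕ, n₀ ≤ n → ∀ j : ℕ,
    |(((Finset.Ico j (j + n)).filter fun i => i ∈ A).card : ℝ) / (n : ℝ) - α| < ε

/-- **Krylov–Bogolyubov**: the orbit closure of a point under a continuous self-map of a compact
space carries an invariant probability measure. -/
theorem exists_invariant_probabilityMeasure {X : Type*} [TopologicalSpace X] [CompactSpace X]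
    [T2Space X] [HasOuterApproxClosed X] [MeasurableSpace X] [BorelSpace X] {T : X → X}
    (hT : Continuous T) (x : X) :
    ∃ μ : Measure X, IsProbabilityMeasure μ ∧ μ.map T = μ ∧
      μ (closure {y | ∃ n : ℕ, y = T^[n] x}) = 1 := by
  set K := closure {y | ∃ n : ℕ, y = T^[n] x}
  let m (n : ℕ) : Measure X :=
    ((n + 1 : ℕ) : ENNReal)⁻¹ • ∑ i ∈ Finset.range (n + 1), Measure.dirac (T^[i] x)
  have hm1 (n : ℕ) (s : Set X) (hs : ∀ i, T^[i] x ∈ s) : m n s = 1 := by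
    have : ∀ i ∈ Finset.range (n + 1), Measure.dirac (T^[i] x) s = 1 := fun i _ => by
      refine le_antisymm prob_le_one ?_
      exact (by simp [hs i] : (1 : ENNReal) = s.indicator 1 (T^[i] x)).trans_le
        Measure.le_dirac_apply
    simp only [m, Measure.smul_apply, Measure.finsetSum_apply, Finset.sum_congr rfl this,
      Finset.sum_const, Finset.card_range, smul_eq_mul, nsmul_eq_mul, mul_one]
    exact ENNReal.inv_mul_cancel (by simp) (ENNReal.natCast_ne_top _)
  have hprob (n : ℕ) : IsProbabilityMeasure (m n) := ⟨hm1 n _ fun _ => mem_univ _⟩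
  have hint (f : BoundedContinuousFunction X ℝ) (n : ℕ) :
      ∫ y, f y ∂(m n) = birkhoffAverage ℝ T f (n + 1) x := by
    simp only [m]
    rw [integral_smul_measure, integral_finsetSum_measure fun i _ => f.integrable _]
    simp only [integral_dirac, birkhoffAverage, birkhoffSum]
    congr 1
    rw [ENNReal.toReal_inv, ENNReal.toReal_natCast]
  let ν (n : ℕ) : ProbabilityMeasure X := ⟨m n, hprob n⟩
  obtain ⟨μ, -, hμ⟩ := isCompact_univ.ultrafilter_le_nhds ((hyperfilter ℕ).map ν) (by simp)
  have hlim : Tendsto ν (hyperfilter ℕ) (𝓝 μ) := hμ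
  refine ⟨μ, inferInstance, ?_, ?_⟩
  · have : IsProbabilityMeasure ((μ : Measure X).map T) :=
      Measure.isProbabilityMeasure_map hT.aemeasurable
    refine ext_of_forall_integral_eq_of_IsFiniteMeasure fun f => ?_
    rw [integral_map hT.aemeasurable f.continuous.aestronglyMeasurable]
    have h1 := ProbabilityMeasure.tendsto_iff_forall_integral_tendsto.1 hlim f
    have h2 := ProbabilityMeasure.tendsto_iff_forall_integral_tendsto.1 hlim
      (f.compContinuous ⟨T, hT⟩)
    have h3 := ((tendsto_birkhoffAverage_apply_sub_birkhoffAverage' ℝ f.isBounded_range T x).comp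
      (tendsto_add_atTop_nat 1)).mono_left Nat.hyperfilter_le_atTop
    refine sub_eq_zero.1 (tendsto_nhds_unique (h2.sub h1) (h3.congr fun n => ?_))
    simp only [ν, ProbabilityMeasure.coe_mk, hint, Function.comp_apply]
    congr 1
    simp only [birkhoffAverage, birkhoffSum, ← Function.iterate_succ_apply,
      BoundedContinuousFunction.compContinuous_apply, ContinuousMap.coe_mk,
      ← Function.iterate_succ_apply']
  · refine le_antisymm prob_le_one ?_
    have h := ProbabilityMeasure.limsup_measure_closed_le_of_tendsto hlim
      (isClosed_closure : IsClosed K)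
    have hν (n : ℕ) : (ν n : Measure X) K = 1 := hm1 n K fun i => subset_closure ⟨i, rfl⟩
    rwa [show (fun n => (ν n : Measure X) K) = fun _ => 1 from funext hν, limsup_const] at h

/-- An invariant probability measure integrates a function to the integral of its Birkhoff
averages. -/
theorem integral_birkhoffAverage_eq {X : Type*} [TopologicalSpace X] [MeasurableSpace X]
    [BorelSpace X] {T : X → X} (hT : Continuous T) {μ : Measure X} [IsProbabilityMeasure μ]
    (hμ : μ.map T = μ) (f : BoundedContinuousFunction X ℝ) {n : ℕ} (hn : n ≠ 0) :
    ∫ y, birkhoffAverage ℝ T f n y ∂μ = ∫ y, f y ∂μ := by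
  have hmp : MeasurePreserving T μ μ := ⟨hT.measurable, hμ⟩
  have hiter (k : ℕ) : ∫ y, f (T^[k] y) ∂μ = ∫ y, f y ∂μ := by
    rw [← integral_map (hT.iterate k).aemeasurable f.continuous.aestronglyMeasurable,
      (hmp.iterate k).map_eq]
  have hi (k : ℕ) : Integrable (fun y => f (T^[k] y)) μ :=
    (f.compContinuous ⟨T^[k], hT.iterate k⟩).integrable μ
  simp only [birkhoffAverage, birkhoffSum, smul_eq_mul]
  rw [integral_const_mul, integral_finsetSum _ fun k _ => hi k]
  simp only [hiter, Finset.sum_const, Finset.card_range, nsmul_eq_mul]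
  field_simp

/-- If the Birkhoff averages of every bounded continuous function are eventually almost constant
on a set, then that set fully supports at most one invariant probability measure. -/
theorem invariant_measure_unique_of_birkhoffAverage {X : Type*} [TopologicalSpace X]
    [HasOuterApproxClosed X] [MeasurableSpace X] [BorelSpace X] {T : X → X} (hT : Continuous T)
    {K : Set X} (hK : IsClosed K)
    (h : ∀ f : BoundedContinuousFunction X ℝ, ∀ ε > 0, ∃ n ≠ 0, ∃ c : ℝ, ∀ y ∈ K,
      |birkhoffAverage ℝ T f n y - c| ≤ ε)
    {μ ν : Measure X} [IsProbabilityMeasure μ] [IsProbabilityMeasure ν]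
    (hμ : μ.map T = μ) (hν : ν.map T = ν) (hμK : μ K = 1) (hνK : ν K = 1) : μ = ν := by
  refine ext_of_forall_integral_eq_of_IsFiniteMeasure fun f =>
    eq_of_abs_sub_le_all fun ε hε => ?_
  obtain ⟨n, hn, c, hc⟩ := h f (ε / 2) (half_pos hε)
  have key (ρ : Measure X) [IsProbabilityMeasure ρ] (hρ : ρ.map T = ρ) (hρK : ρ K = 1) :
      |∫ y, f y ∂ρ - c| ≤ ε / 2 := by
    have hae : ∀ᵐ y ∂ρ, ‖birkhoffAverage ℝ T f n y - c‖ ≤ ε / 2 :=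
      Eventually.mono ((mem_ae_iff_prob_eq_one hK.measurableSet).2 hρK) hc
    have hi : Integrable (birkhoffAverage ℝ T f n) ρ :=
      (integrable_finsetSum _ fun k _ =>
        (f.compContinuous ⟨T^[k], hT.iterate k⟩).integrable ρ).const_mul _
    have := norm_integral_le_of_norm_le_const hae
    rwa [integral_sub hi (integrable_const c), integral_birkhoffAverage_eq hT hρ f hn,
      integral_const, probReal_univ, one_smul, mul_one] at this
  have h1 := abs_le.1 (key μ hμ hμK)
  have h2 := abs_le.1 (key ν hν hνK)
  exact abs_le.2 ⟨by linarith, by linarith⟩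

/-- The averages of `g` over the windows `[j, j + n)` tend to `c` as `n → ∞`, uniformly in `j`. -/
def HasUniformMean (g : ℕ → ℝ) (c : ℝ) : Prop :=
  ∀ ε > 0, ∃ n₀ : ℕ, ∀ n ≥ n₀, ∀ j : ℕ,
    |∑ t ∈ Finset.range n, g (j + t) - n * c| ≤ ε * n

theorem HasUniformMean.zero : HasUniformMean (fun _ => 0) 0 := fun ε hε =>
  ⟨0, fun n _ j => by simp; positivity⟩

theorem HasUniformMean.add {g h : ℕ → ℝ} {c d : ℝ} (hg : HasUniformMean g c)
    (hh : HasUniformMean h d) : HasUniformMean (fun i => g i + h i) (c + d) := by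
  intro ε hε
  obtain ⟨N, hN⟩ := hg (ε / 2) (half_pos hε)
  obtain ⟨M, hM⟩ := hh (ε / 2) (half_pos hε)
  refine ⟨max N M, fun n hn j => ?_⟩
  have h1 := abs_le.1 (hN n (le_of_max_le_left hn) j)
  have h2 := abs_le.1 (hM n (le_of_max_le_right hn) j)
  rw [Finset.sum_add_distrib]
  exact abs_le.2 ⟨by linarith, by linarith⟩

theorem HasUniformMean.const_mul {g : ℕ → ℝ} {c : ℝ} (hg : HasUniformMean g c) (a : ℝ) :
    HasUniformMean (fun i => a * g i) (a * c) := by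
  intro ε hε
  have ha : 0 < |a| + 1 := by positivity
  obtain ⟨N, hN⟩ := hg (ε / (|a| + 1)) (by positivity)
  refine ⟨N, fun n hn j => ?_⟩
  rw [← Finset.mul_sum, ← mul_left_comm a, ← mul_sub,
    abs_mul]
  calc |a| * |∑ t ∈ Finset.range n, g (j + t) - n * c|
      ≤ (|a| + 1) * (ε / (|a| + 1) * n) := by
        gcongr
        · linarith
        · exact hN n hn j
    _ = ε * n := by field_simp

theorem HasUniformMean.sum {ι : Type*} (s : Finset ι) {g : ι → ℕ → ℝ} {c : ι → ℝ}
    (h : ∀ v ∈ s, HasUniformMean (g v) (c v)) :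
    HasUniformMean (fun i => ∑ v ∈ s, g v i) (∑ v ∈ s, c v) := by
  classical
  induction s using Finset.induction_on with
  | empty => simpa using HasUniformMean.zero
  | insert a s ha ih =>
    simp only [Finset.sum_insert ha]
    exact (h a (s.mem_insert_self a)).add (ih fun v hv => h v (Finset.mem_insert_of_mem hv))

open scoped Classical in
theorem UniformCesaro.exists_hasUniformMean {A : Set ℕ} (hA : UniformCesaro A) :
    ∃ c, HasUniformMean (fun i => if i ∈ A then 1 else 0) c := by
  obtain ⟨α, -, h⟩ := hA
  refine ⟨α, fun ε hε => ?_⟩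
  obtain ⟨N, hN⟩ := h ε hε
  refine ⟨max N 1, fun n hn j => ?_⟩
  have hn0 : (0 : ℝ) < n := by exact_mod_cast le_of_max_le_right hn
  have := (hN n (le_of_max_le_left hn) j).le
  rw [← Finset.sum_boole, Finset.sum_Ico_eq_sum_range, Nat.add_sub_cancel_left] at this
  set s := ∑ t ∈ Finset.range n, if j + t ∈ A then (1 : ℝ) else 0
  rw [show s / n - α = (s - n * α) / n by field_simp, abs_div, abs_of_pos hn0,
    div_le_iff₀ hn0] at this
  exact this

/-- A real function of a finite-valued sequence has a uniform mean if every value of the sequence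
is attained along a uniform Cesàro set. -/
theorem exists_hasUniformMean_comp {ι : Type*} [Fintype ι] (G : ι → ℝ) (b : ℕ → ι)
    (h : ∀ v, UniformCesaro {i | b i = v}) : ∃ c, HasUniformMean (fun i => G (b i)) c := by
  classical
  choose c hc using fun v => (h v).exists_hasUniformMean
  refine ⟨∑ v, G v * c v, ?_⟩
  convert HasUniformMean.sum Finset.univ fun v _ => (hc v).const_mul (G v) using 2 with i
  simp

theorem sum_range_mul_eq_sum_blocks (g : ℕ → ℝ) (m L : ℕ) :
    ∑ t ∈ Finset.range (m * L), g t =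
      ∑ b ∈ Finset.range m, ∑ r ∈ Finset.range L, g (b * L + r) := by
  induction m with
  | zero => simp
  | succ m ih => rw [Nat.succ_mul, Finset.sum_range_add, ih, Finset.sum_range_succ]

/-- Translating a window by `s` changes the sum of a function bounded by `M` by at most
`2 * M * s`. -/
theorem abs_sum_window_sub_le {g : ℕ → ℝ} {M : ℝ} (hg : ∀ i, |g i| ≤ M) (a n s : ℕ) :
    |∑ t ∈ Finset.range n, g (a + s + t) - ∑ t ∈ Finset.range n, g (a + t)| ≤ 2 * M * s := by
  induction s with
  | zero => simp
  | succ s ih =>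
    have h := Finset.sum_range_succ' (fun t => g (a + s + t)) n
    rw [Finset.sum_range_succ] at h
    simp only [add_zero, ← add_assoc] at h
    have h1 := abs_le.1 ih
    have h2 := abs_le.1 (hg (a + s + n))
    have h3 := abs_le.1 (hg (a + s))
    simp only [← add_assoc, Nat.cast_add_one, add_right_comm _ 1] at h ⊢
    exact abs_le.2 ⟨by linarith, by linarith⟩

/-- If `g` is, up to an average error `ε` on each block `[i * L, (i + 1) * L)`, given by a function
with a uniform mean, then the averages of `g` over long enough windows are almost constant. -/
theorem exists_window_average_almost_const {g H : ℕ → ℝ} {M c ε : ℝ} {L : ℕ} (hε : 0 < ε)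
    (hL : 0 < L) (hg : ∀ i, |g i| ≤ M) (hH : HasUniformMean H c)
    (hgH : ∀ i, |∑ r ∈ Finset.range L, g (i * L + r) - H i| ≤ ε * L) :
    ∃ n : ℕ, n ≠ 0 ∧ ∃ d : ℝ, ∀ a, |(n : ℝ)⁻¹ * ∑ t ∈ Finset.range n, g (a + t) - d| ≤ 3 * ε := by
  obtain ⟨N, hN⟩ := hH ε hε
  obtain ⟨m, hm⟩ := exists_nat_ge (max (max N 1 : ℝ) (2 * M / ε))
  have hM : 0 ≤ M := (abs_nonneg _).trans (hg 0)
  have hmN : N ≤ m := by exact_mod_cast (le_max_left _ _).trans ((le_max_left _ _).trans hm)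
  have hm1 : 1 ≤ m := by exact_mod_cast (le_max_right _ _).trans ((le_max_left _ _).trans hm)
  have hmM : 2 * M ≤ m * ε := (div_le_iff₀ hε).1 ((le_max_right _ _).trans hm)
  have hL' : (1 : ℝ) ≤ L := by exact_mod_cast hL
  have hm' : (1 : ℝ) ≤ m := by exact_mod_cast hm1
  have hn : (0 : ℝ) < m * L := by positivity
  refine ⟨m * L, by positivity, c / L, fun a => ?_⟩
  have hshift := abs_le.1 (abs_sum_window_sub_le hg (a / L * L) (m * L) (a % L))
  rw [Nat.div_add_mod'] at hshift
  have hblocks : |∑ t ∈ Finset.range (m * L), g (a / L * L + t) -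
      ∑ b ∈ Finset.range m, H (a / L + b)| ≤ m * (ε * L) := by
    rw [sum_range_mul_eq_sum_blocks fun t => g (a / L * L + t), ← Finset.sum_sub_distrib]
    refine (Finset.abs_sum_le_sum_abs _ _).trans ?_
    refine (Finset.sum_le_card_nsmul _ _ (ε * L) fun b _ => ?_).trans (by simp)
    simpa only [add_mul, add_assoc] using hgH (a / L + b)
  have hblocks := abs_le.1 hblocks
  have hmean := abs_le.1 (hN m hmN (a / L))
  have hs : 2 * M * (a % L : ℕ) ≤ m * ε * L := by
    gcongr
    exact (Nat.mod_lt a hL).le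
  have hεm : ε * m ≤ ε * m * L := le_mul_of_one_le_right (by positivity) hL'
  set S := ∑ t ∈ Finset.range (m * L), g (a + t)
  have hS : |S - m * c| ≤ 3 * ε * (m * L) := abs_le.2 ⟨by linarith, by linarith⟩
  push_cast
  rw [show ((m : ℝ) * L)⁻¹ * S - c / L = (S - m * c) / (m * L) by field_simp, abs_div,
    abs_of_pos hn, div_le_iff₀ hn]
  exact hS

theorem shiftMap_iterate_apply {p : ℕ} (n : ℕ) (x : ℕ → Fin p) (i : ℕ) :
    (shiftMap p)^[n] x i = x (n + i) := by
  induction n generalizing i with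
  | zero => simp
  | succ n ih =>
    rw [Function.iterate_succ_apply', shiftMap, ih]
    congr 1
    omega

theorem continuous_shiftMap (p : ℕ) : Continuous (shiftMap p) :=
  continuous_pi fun n => continuous_apply (n + 1)

/-- A neighborhood of a point of the full shift contains all points sharing a long enough prefix
with it. -/
theorem exists_prefix_subset_of_mem_nhds {p : ℕ} {y : ℕ → Fin p} {U : Set (ℕ → Fin p)}
    (hU : U ∈ 𝓝 y) : ∃ k : ℕ, ∀ z : ℕ → Fin p, (∀ t < k, z t = y t) → z ∈ U := by
  obtain ⟨s, ⟨w, k, rfl⟩, hy, hs⟩ :=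
    (PiNat.isTopologicalBasis_cylinders fun _ : ℕ => Fin p).mem_nhds_iff.1 hU
  exact ⟨k, fun z hz => hs (PiNat.mem_cylinder_iff.2 fun i hi =>
    (hz i hi).trans (PiNat.mem_cylinder_iff.1 hy i hi))⟩

theorem prefix_mem_nhds {p : ℕ} (y : ℕ → Fin p) (k : ℕ) :
    {z : ℕ → Fin p | ∀ t < k, z t = y t} ∈ 𝓝 y :=
  (PiNat.isOpen_cylinder (fun _ : ℕ => Fin p) y k).mem_nhds (PiNat.self_mem_cylinder y k)

/-- A continuous function on the full shift is determined up to `ε` by a long enough prefix. -/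
theorem exists_prefix_abs_sub_le {p : ℕ} {f : (ℕ → Fin p) → ℝ} (hf : Continuous f) {ε : ℝ}
    (hε : 0 < ε) : ∃ k : ℕ, ∀ y z : ℕ → Fin p, (∀ t < k, y t = z t) → |f y - f z| ≤ ε := by
  obtain ⟨δ, hδ, h⟩ := Metric.uniformContinuous_iff.1
    (CompactSpace.uniformContinuous_of_continuous hf) ε hε
  obtain ⟨k, hk⟩ := exists_pow_lt_of_lt_one hδ (one_half_lt_one (α := ℝ))
  refine ⟨k, fun y z hyz => (h ?_).le⟩
  exact (PiNat.mem_cylinder_iff_dist_le.1 (PiNat.mem_cylinder_iff.2 hyz)).trans_lt hk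

/-- The orbit closure of an almost periodic point of the full shift is minimal. -/
theorem eq_orbitClosure_of_almostPeriodic {p : ℕ} {x : ℕ → Fin p}
    (hx : ∀ U ∈ 𝓝 x, ∃ N : ℕ, ∀ n : ℕ, ∃ m : ℕ, n ≤ m ∧ m ≤ n + N ∧ (shiftMap p)^[m] x ∈ U)
    {Y : Set (ℕ → Fin p)} (hYx : Y ⊆ closure {y | ∃ n : ℕ, y = (shiftMap p)^[n] x})
    (hne : Y.Nonempty) (hY : IsClosed Y) (hYT : MapsTo (shiftMap p) Y Y) :
    Y = closure {y | ∃ n : ℕ, y = (shiftMap p)^[n] x} := by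
  refine hYx.antisymm (closure_minimal ?_ hY)
  suffices hxY : x ∈ Y by
    rintro _ ⟨n, rfl⟩
    exact hYT.iterate n hxY
  rw [← hY.closure_eq, mem_closure_iff_nhds]
  intro U hU
  obtain ⟨y, hy⟩ := hne
  obtain ⟨k, hk⟩ := exists_prefix_subset_of_mem_nhds hU
  obtain ⟨N, hN⟩ := hx _ (prefix_mem_nhds x k)
  obtain ⟨_, hz, n, rfl⟩ :=
    mem_closure_iff_nhds.1 (hYx hy) _ (prefix_mem_nhds y (N + k))
  obtain ⟨m, hnm, hmN, hm⟩ := hN n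
  refine ⟨(shiftMap p)^[m - n] y, hk _ fun t ht => ?_, hYT.iterate _ hy⟩
  rw [← hm t ht, shiftMap_iterate_apply, shiftMap_iterate_apply, ← hz _ (by omega),
    shiftMap_iterate_apply]
  congr 1
  omega

/-- If `f` is determined up to `ε` by prefixes of length `k` and is bounded by `M`, then its sums
along the first `L` shifts of two points sharing a prefix of length `L` are close. -/
theorem abs_sum_shift_sub_le_of_prefix {p : ℕ} {f : (ℕ → Fin p) → ℝ} {M ε : ℝ} {k L : ℕ}
    (hM : ∀ y, |f y| ≤ M) (hε : 0 ≤ ε)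
    (hk : ∀ y z : ℕ → Fin p, (∀ t < k, y t = z t) → |f y - f z| ≤ ε)
    {y z : ℕ → Fin p} (hyz : ∀ t < L, y t = z t) :
    |∑ r ∈ Finset.range L, f ((shiftMap p)^[r] y) - ∑ r ∈ Finset.range L, f ((shiftMap p)^[r] z)|
      ≤ ε * L + 2 * M * k := by
  have hM0 : 0 ≤ M := (abs_nonneg _).trans (hM y)
  rw [← Finset.sum_sub_distrib]
  calc |∑ r ∈ Finset.range L, (f ((shiftMap p)^[r] y) - f ((shiftMap p)^[r] z))|
      ≤ ∑ r ∈ Finset.range L, (ε + if L - k ≤ r then 2 * M else 0) := by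
        refine (Finset.abs_sum_le_sum_abs _ _).trans (Finset.sum_le_sum fun r hr => ?_)
        rw [Finset.mem_range] at hr
        split_ifs with h
        · have h1 := abs_le.1 (hM ((shiftMap p)^[r] y))
          have h2 := abs_le.1 (hM ((shiftMap p)^[r] z))
          exact abs_le.2 ⟨by linarith, by linarith⟩
        · rw [add_zero]
          refine hk _ _ fun t ht => ?_
          rw [shiftMap_iterate_apply, shiftMap_iterate_apply]
          exact hyz _ (by omega)
    _ = ε * L + 2 * M * ((Finset.range L).filter fun r => L - k ≤ r).card := by
        rw [Finset.sum_add_distrib, ← Finset.sum_filter]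
        simp [mul_comm]
    _ ≤ ε * L + 2 * M * k := by
        have : ((Finset.range L).filter fun r => L - k ≤ r) ⊆ Finset.Ico (L - k) L := fun r => by
          simp only [Finset.mem_filter, Finset.mem_range, Finset.mem_Ico]
          exact And.symm
        have := Finset.card_le_card this
        rw [Nat.card_Ico] at this
        gcongr
        omega

/-- If for arbitrarily large `L` every word occurs in the decomposition of `x` into blocks of
length `L` along a uniform Cesàro set, then the Birkhoff averages of continuous functions are
almost constant on the orbit closure of `x`. -/
theorem exists_birkhoffAverage_almost_const {p : ℕ} {x : ℕ → Fin p}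
    (hx : ∀ N : ℕ, ∃ L ≥ N, 0 < L ∧ ∀ v : Fin L → Fin p,
      UniformCesaro {i : ℕ | ∀ t : Fin L, x (i * L + (t : ℕ)) = v t})
    (f : BoundedContinuousFunction (ℕ → Fin p) ℝ) {ε : ℝ} (hε : 0 < ε) :
    ∃ n ≠ 0, ∃ c : ℝ, ∀ y ∈ closure {y | ∃ n : ℕ, y = (shiftMap p)^[n] x},
      |birkhoffAverage ℝ (shiftMap p) f n y - c| ≤ ε := by
  have hM (y : ℕ → Fin p) : |f y| ≤ ‖f‖ := f.norm_coe_le_norm y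
  obtain ⟨k, hk⟩ := exists_prefix_abs_sub_le f.continuous (ε := ε / 6) (by positivity)
  obtain ⟨N, hN⟩ := exists_nat_ge (2 * ‖f‖ * k / (ε / 6))
  obtain ⟨L, hNL, hL, hCes⟩ := hx N
  have hkL : 2 * ‖f‖ * k ≤ L * (ε / 6) :=
    (div_le_iff₀ (by positivity)).1 (hN.trans (Nat.cast_le.2 hNL))
  let extend (v : Fin L → Fin p) : ℕ → Fin p := fun n => if h : n < L then v ⟨n, h⟩ else x n
  let block (i : ℕ) : Fin L → Fin p := fun t => x (i * L + t)
  obtain ⟨c, hc⟩ := exists_hasUniformMean_comp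
    (fun v => ∑ r ∈ Finset.range L, f ((shiftMap p)^[r] (extend v))) block
    fun v => by simpa only [block, funext_iff] using hCes v
  obtain ⟨n, hn, d, hd⟩ := exists_window_average_almost_const
    (g := fun i => f ((shiftMap p)^[i] x)) (ε := ε / 3) (by positivity) hL (fun i => hM _) hc
    fun i => by
      have h := abs_sum_shift_sub_le_of_prefix hM (by positivity) hk (L := L)
        (y := (shiftMap p)^[i * L] x) (z := extend (block i)) fun t ht => by
          simp only [extend, block, shiftMap_iterate_apply, dif_pos ht]
      simp only [← Function.iterate_add_apply, add_comm _ (i * L)] at h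
      exact h.trans (by linarith)
  refine ⟨n, hn, d, fun y hy => ?_⟩
  have hcont : Continuous (birkhoffAverage ℝ (shiftMap p) f n) :=
    (continuous_finsetSum _ fun r _ =>
      f.continuous.comp ((continuous_shiftMap p).iterate r)).const_smul (n : ℝ)⁻¹
  refine closure_minimal (t := {y | |birkhoffAverage ℝ (shiftMap p) f n y - d| ≤ ε}) ?_
    (isClosed_le (hcont.sub continuous_const).abs continuous_const) hy
  rintro _ ⟨a, rfl⟩
  have h := hd a
  rw [mul_div_cancel₀ _ three_ne_zero] at h
  simpa only [mem_ofPred_eq, birkhoffAverage, birkhoffSum, smul_eq_mul,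
    ← Function.iterate_add_apply, add_comm _ a] using h

/-- If `x ∈ Σ_p` is almost periodic and, for an increasing sequence `(l_j)` with
`l_j ∣ l_{j+1}`, the set `N_x^{(l_j)}(v) = {i : x[i·l_j,(i+1)·l_j) = v}` is uniform Cesàro for
every `l_j`-word `v`, then the subshift on the orbit closure of `x` is strictly ergodic
(minimal and uniquely ergodic). -/
theorem strictlyErgodic_of_uniformCesaro (p : ℕ) (hp : 2 ≤ p) (x : ℕ → Fin p)
    (hAP : ∀ U ∈ 𝓝 x, ∃ N : ℕ, ∀ n : ℕ, ∃ m : ℕ, n ≤ m ∧ m ≤ n + N ∧ (shiftMap p)^[m] x ∈ U)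
    (l : ℕ → ℕ) (hlpos : ∀ j, 0 < l j) (hlmono : StrictMono l)
    (hldvd : ∀ j, l j ∣ l (j + 1))
    (hCes : ∀ j : ℕ, ∀ v : Fin (l j) → Fin p,
      UniformCesaro {i : ℕ | ∀ t : Fin (l j), x (i * l j + (t : ℕ)) = v t}) :
    (∀ Y : Set (ℕ → Fin p), Y ⊆ closure {y | ∃ n : ℕ, y = (shiftMap p)^[n] x} →
        Y.Nonempty → IsClosed Y → Set.MapsTo (shiftMap p) Y Y →
        Y = closure {y | ∃ n : ℕ, y = (shiftMap p)^[n] x}) ∧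
    (∃! μ : Measure (ℕ → Fin p), IsProbabilityMeasure μ ∧ μ.map (shiftMap p) = μ ∧
        μ (closure {y | ∃ n : ℕ, y = (shiftMap p)^[n] x}) = 1) := by
  refine ⟨fun Y hYx hne hY hYT => eq_orbitClosure_of_almostPeriodic hAP hYx hne hY hYT, ?_⟩
  obtain ⟨μ, hμ, hμT, hμK⟩ := exists_invariant_probabilityMeasure (continuous_shiftMap p) x
  refine ⟨μ, ⟨hμ, hμT, hμK⟩, fun ν ⟨_, hνT, hνK⟩ => ?_⟩
  refine invariant_measure_unique_of_birkhoffAverage (continuous_shiftMap p) isClosed_closure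
    (fun f ε hε => exists_birkhoffAverage_almost_const (fun N => ?_) f hε) hνT hμT hνK hμK
  exact ⟨l N, hlmono.id_le N, hlpos N, hCes N⟩
end
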